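/- (Key symbol identity for the spectral asymmetry of odd class operators of odd order in even dimension.) With the data described in the context — n even, m odd, k an integer with km ≤ n, the sectorial-projection symbols π_{−j} satisfying π_0(x, −ξ) = 1 − π_0(x, ξ) and π_{−j}(x, −ξ) = (−1)^{j+1} π_{−j}(x, ξ) for j ≥ 1, and the odd class symbols p^{(k)}_{−km−l} satisfying p^{(k)}_{−km−l}(x, −ξ) = (−1)^{km+l} p^{(k)}_{−km−l}(x, ξ) — the function r^{(k)}_{−n}(x, ξ) = Σ_{|α|+j+l = n−km} (1/α!) (∂_ξ^α π_{−j})(x, ξ) (D_x^α p^{(k)}_{−km−l})(x, ξ) satisfies r^{(k)}_{−n}(x, ξ) + r^{(k)}_{−n}(x, −ξ) = p^{(k)}_{−n}(x, ξ) for all (x, ξ) ∈ U × (ℝ^n ∖ {0}). -/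

import Mathlib

open Complex

noncomputable section

attribute [local instance] Matrix.linftyOpNormedRing Matrix.linftyOpNormedAlgebra

variable {n d : ℕ}

/-- First-order partial derivative `∂/∂x_i` of a function on `ℝⁿ` with values in a normed
space. -/
def pderiv1 {M : Type*} [NormedAddCommGroup M] [NormedSpace ℝ M] (i : Fin n)
    (f : (Fin n → ℝ) → M) : (Fin n → ℝ) → M :=
  fun x => fderiv ℝ f x (Pi.single i 1)

/-- Iterated partial derivatives along a list of coordinate directions. -/
def derivAlong {M : Type*} [NormedAddCommGroup M] [NormedSpace ℝ M] :
    List (Fin n) → ((Fin n → ℝ) → M) → (Fin n → ℝ) → M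
  | [], f => f
  | i :: l, f => pderiv1 i (derivAlong l f)

/-- The list of coordinate directions encoded by a multi-index `α ∈ ℕⁿ`
(direction `i` repeated `α i` times). -/
def multiIndexList (α : Fin n → ℕ) : List (Fin n) :=
  (List.finRange n).flatMap fun i => List.replicate (α i) i

/-- The iterated partial derivative `∂^α = ∂_1^{α 1} ⋯ ∂_n^{α n}` attached to the
multi-index `α`. -/
def mderiv {M : Type*} [NormedAddCommGroup M] [NormedSpace ℝ M] (α : Fin n → ℕ)
    (f : (Fin n → ℝ) → M) : (Fin n → ℝ) → M :=
  derivAlong (multiIndexList α) f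

/-- The length `|α| = α 1 + ⋯ + α n` of a multi-index. -/
def msize (α : Fin n → ℕ) : ℕ := ∑ i, α i

/-- The factorial `α! = (α 1)! ⋯ (α n)!` of a multi-index. -/
def mfact (α : Fin n → ℕ) : ℕ := ∏ i, (α i).factorial

theorem fderiv_const_smul_field' {𝕜 E M : Type*} [NormedField 𝕜] [NormedAddCommGroup E]
    [NormedSpace ℝ E] [NormedAddCommGroup M] [NormedSpace ℝ M] [NormedSpace 𝕜 M]
    [SMulCommClass ℝ 𝕜 M] (c : 𝕜) (f : E → M) (x : E) :
    fderiv ℝ (fun y => c • f y) x = c • fderiv ℝ f x := by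
  rcases eq_or_ne c 0 with rfl | hc
  · simp
  · have := invertibleOfNonzero hc
    exact fderiv_const_smul_of_invertible c

theorem fderiv_comp_neg' {E M : Type*} [NormedAddCommGroup E] [NormedSpace ℝ E]
    [NormedAddCommGroup M] [NormedSpace ℝ M] (f : E → M) (x : E) :
    fderiv ℝ (fun y => f (-y)) x = -fderiv ℝ f (-x) := by
  simpa [Function.comp_def] using fderiv_comp_smul (𝕜 := ℝ) (f := f) (x := x) (-1)

theorem length_multiIndexList (α : Fin n → ℕ) : (multiIndexList α).length = msize α := by
  simp [multiIndexList, msize, List.length_flatMap, List.sum_ofFn, ← List.ofFn_eq_map]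

section DerivAlong

variable {M : Type*} [NormedAddCommGroup M] [NormedSpace ℝ M]

theorem derivAlong_congr {s : Set (Fin n → ℝ)} (hs : IsOpen s) {f g : (Fin n → ℝ) → M}
    (h : Set.EqOn f g s) (L : List (Fin n)) : Set.EqOn (derivAlong L f) (derivAlong L g) s := by
  induction L with
  | nil => exact h
  | cons i L ih =>
    intro x hx
    simp only [derivAlong, pderiv1]
    rw [(ih.eventuallyEq_of_mem (hs.mem_nhds hx)).fderiv_eq]

theorem derivAlong_comp_neg (f : (Fin n → ℝ) → M) (L : List (Fin n)) :
    derivAlong L (fun y => f (-y)) = fun y => (-1 : ℝ) ^ L.length • derivAlong L f (-y) := by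
  induction L with
  | nil => simp [derivAlong]
  | cons i L ih =>
    funext x
    simp only [derivAlong, pderiv1, ih, List.length_cons, pow_succ]
    rw [fderiv_const_smul_field', fderiv_comp_neg']
    simp

theorem derivAlong_const_smul [NormedSpace ℂ M] [SMulCommClass ℝ ℂ M] (c : ℂ) (f : (Fin n → ℝ) → M)
    (L : List (Fin n)) :
    derivAlong L (fun y => c • f y) = fun y => c • derivAlong L f y := by
  induction L with
  | nil => rfl
  | cons i L ih =>
    funext x
    simp only [derivAlong, pderiv1, ih]
    rw [fderiv_const_smul_field']
    rfl

theorem derivAlong_const_sub (a : M) (f : (Fin n → ℝ) → M) {L : List (Fin n)} (hL : L ≠ []) :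
    derivAlong L (fun y => a - f y) = fun y => -derivAlong L f y := by
  induction L with
  | nil => exact absurd rfl hL
  | cons i L ih =>
    funext x
    simp only [derivAlong, pderiv1]
    rcases eq_or_ne L [] with rfl | hL'
    · simp [derivAlong, fderiv_const_sub]
    · rw [ih hL', fderiv_fun_neg]
      rfl

end DerivAlong

section Parity

variable {M : Type*} [NormedAddCommGroup M] [NormedSpace ℝ M]

theorem neg_one_pow_real_smul [NormedSpace ℂ M] (a : ℕ) (v : M) :
    (-1 : ℝ) ^ a • v = (-1 : ℂ) ^ a • v := by
  rcases Nat.even_or_odd a with h | h <;> simp [h.neg_one_pow]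

theorem mderiv_neg_of_odd_complement {f : (Fin n → ℝ) → M} {a : M}
    (h : ∀ ξ, ξ ≠ 0 → f (-ξ) = a - f ξ) {α : Fin n → ℕ} (hα : msize α ≠ 0)
    {ξ : Fin n → ℝ} (hξ : ξ ≠ 0) :
    mderiv α f (-ξ) = (-1 : ℝ) ^ (msize α + 1) • mderiv α f ξ := by
  have hL : multiIndexList α ≠ [] := by
    rwa [ne_eq, ← List.length_eq_zero_iff, length_multiIndexList]
  have key := derivAlong_congr isOpen_ne h (multiIndexList α) hξ
  rw [derivAlong_comp_neg, derivAlong_const_sub a f hL, length_multiIndexList] at key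
  have := congrArg (fun v => (-1 : ℝ) ^ msize α • v) key
  simpa [mderiv, smul_smul, ← mul_pow, pow_succ] using this

theorem mderiv_neg_of_parity [NormedSpace ℂ M] [SMulCommClass ℝ ℂ M] {f : (Fin n → ℝ) → M}
    {c : ℂ} (h : ∀ ξ, ξ ≠ 0 → f (-ξ) = c • f ξ) (α : Fin n → ℕ)
    {ξ : Fin n → ℝ} (hξ : ξ ≠ 0) :
    mderiv α f (-ξ) = (-1 : ℝ) ^ msize α • c • mderiv α f ξ := by
  have key := derivAlong_congr isOpen_ne h (multiIndexList α) hξ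
  rw [derivAlong_comp_neg, derivAlong_const_smul, length_multiIndexList] at key
  have := congrArg (fun v => (-1 : ℝ) ^ msize α • v) key
  simpa [mderiv, smul_smul, ← mul_pow] using this

end Parity

/-- **key symbol identity for the spectral asymmetry of odd class operators of
odd order in even dimension.** Let `n ≥ 2` be even, `m ≥ 1` odd, `k ∈ ℤ` with `km ≤ n`, and
`N = n - km`. Let `piSym j` (standing for `π_{-j}`, `0 ≤ j ≤ N`) be smooth on
`U × (ℝⁿ ∖ {0})` with `π_0(x,-ξ) = 1 - π_0(x,ξ)` and `π_{-j}(x,-ξ) = (-1)^{j+1} π_{-j}(x,ξ)`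
for `j ≥ 1`, and let `pSym l` (standing for `p^{(k)}_{-km-l}`, `0 ≤ l ≤ N`) be smooth with the
odd class parity `p^{(k)}_{-km-l}(x,-ξ) = (-1)^{km+l} p^{(k)}_{-km-l}(x,ξ)`. Then
`r^{(k)}_{-n}(x,ξ) = Σ_{|α|+j+l=N} (1/α!) ∂_ξ^α π_{-j} · D_x^α p^{(k)}_{-km-l}` satisfies
`r^{(k)}_{-n}(x,ξ) + r^{(k)}_{-n}(x,-ξ) = p^{(k)}_{-n}(x,ξ)` on `U × (ℝⁿ ∖ {0})`. -/
theorem odd_class_symbol_identity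
    (hn : Even n) (hn2 : 2 ≤ n) (hd : 1 ≤ d)
    (m : ℕ) (hm : Odd m) (hm1 : 1 ≤ m) (k : ℤ) (hkm : k * (m : ℤ) ≤ (n : ℤ))
    (N : ℕ) (hN : (N : ℤ) = (n : ℤ) - k * (m : ℤ))
    (U : Set (Fin n → ℝ)) (hU : IsOpen U)
    (piSym : ℕ → (Fin n → ℝ) → (Fin n → ℝ) → Matrix (Fin d) (Fin d) ℂ)
    (hpiSmooth : ∀ j ≤ N, ContDiffOn ℝ (⊤ : ℕ∞)
      (fun w : (Fin n → ℝ) × (Fin n → ℝ) => piSym j w.1 w.2) (U ×ˢ {ξ : Fin n → ℝ | ξ ≠ 0}))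
    (hpi0 : ∀ x ∈ U, ∀ ξ : Fin n → ℝ, ξ ≠ 0 → piSym 0 x (-ξ) = 1 - piSym 0 x ξ)
    (hpij : ∀ j, 1 ≤ j → j ≤ N → ∀ x ∈ U, ∀ ξ : Fin n → ℝ, ξ ≠ 0 →
      piSym j x (-ξ) = ((-1 : ℂ) ^ (j + 1)) • piSym j x ξ)
    (pSym : ℕ → (Fin n → ℝ) → (Fin n → ℝ) → Matrix (Fin d) (Fin d) ℂ)
    (hpSmooth : ∀ l ≤ N, ContDiffOn ℝ (⊤ : ℕ∞)
      (fun w : (Fin n → ℝ) × (Fin n → ℝ) => pSym l w.1 w.2) (U ×ˢ {ξ : Fin n → ℝ | ξ ≠ 0}))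
    (hppar : ∀ l ≤ N, ∀ x ∈ U, ∀ ξ : Fin n → ℝ, ξ ≠ 0 →
      pSym l x (-ξ) = ((-1 : ℂ) ^ (k * (m : ℤ) + (l : ℤ))) • pSym l x ξ)
    (R : (Fin n → ℝ) → (Fin n → ℝ) → Matrix (Fin d) (Fin d) ℂ)
    (hR : R = fun x ξ =>
      ∑ α ∈ Fintype.piFinset (fun _ : Fin n => Finset.range (N + 1)),
        ∑ j ∈ Finset.range (N + 1), ∑ l ∈ Finset.range (N + 1),
          if msize α + j + l = N then
            ((mfact α : ℂ))⁻¹ •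
              (mderiv α (piSym j x) ξ *
                ((-Complex.I) ^ msize α • mderiv α (fun y => pSym l y ξ) x))
          else 0) :
    ∀ x ∈ U, ∀ ξ : Fin n → ℝ, ξ ≠ 0 → R x ξ + R x (-ξ) = pSym N x ξ := by
  intro x hx ξ hξ
  have hp : ∀ (α : Fin n → ℕ) (l : ℕ), l ≤ N → mderiv α (fun y => pSym l y (-ξ)) x =
      (-1 : ℂ) ^ (k * (m : ℤ) + (l : ℤ)) • mderiv α (fun y => pSym l y ξ) x := by
    intro α l hl
    have h := derivAlong_congr hU (fun y hy => hppar l hl y hy ξ hξ) (multiIndexList α) hx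
    rwa [derivAlong_const_smul] at h
  have hpi : ∀ (α : Fin n → ℕ) (j : ℕ), j ≤ N → msize α + j ≠ 0 →
      mderiv α (piSym j x) (-ξ) = (-1 : ℂ) ^ (msize α + j + 1) • mderiv α (piSym j x) ξ := by
    intro α j hj hαj
    rcases Nat.eq_zero_or_pos j with rfl | hj0
    · rw [mderiv_neg_of_odd_complement (hpi0 x hx) hαj hξ, neg_one_pow_real_smul, add_zero]
    · rw [mderiv_neg_of_parity (hpij j hj0 hj x hx) α hξ, neg_one_pow_real_smul, smul_smul,
        ← pow_add, add_assoc]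
  have hsign : ∀ a j l : ℕ, a + j + l = N →
      (-1 : ℂ) ^ (a + j + 1) * (-1 : ℂ) ^ (k * (m : ℤ) + (l : ℤ)) = -1 := by
    intro a j l h
    have h1 : ((-1 : ℂ) ^ (a + j + 1)) = (-1 : ℂ) ^ ((a + j + 1 : ℕ) : ℤ) := (zpow_natCast _ _).symm
    rw [h1, ← zpow_add₀ (by norm_num)]
    apply Odd.neg_one_zpow
    have : ((a + j + 1 : ℕ) : ℤ) + (k * (m : ℤ) + (l : ℤ)) = n + 1 := by
      push_cast; rw [← h] at hN; push_cast at hN; linarith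
    rw [this]
    exact ((Int.even_coe_nat n).2 hn).add_one
  have hN0 : (-1 : ℂ) ^ (k * (m : ℤ) + (N : ℤ)) = 1 := by
    simpa using hsign 0 0 N (by simp)
  have hterm : ∀ (α : Fin n → ℕ) (j l : ℕ), j ≤ N → l ≤ N →
      ((if msize α + j + l = N then
        ((mfact α : ℂ))⁻¹ •
          (mderiv α (piSym j x) ξ *
            ((-Complex.I) ^ msize α • mderiv α (fun y => pSym l y ξ) x))
      else 0) +
      (if msize α + j + l = N then
        ((mfact α : ℂ))⁻¹ •
          (mderiv α (piSym j x) (-ξ) *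
            ((-Complex.I) ^ msize α • mderiv α (fun y => pSym l y (-ξ)) x))
      else 0)) = if α = 0 then if j = 0 then if l = N then pSym N x ξ else 0 else 0 else 0 := by
    intro α j l hj hl
    have hmsize : msize α = 0 ↔ α = 0 := by simp [msize, funext_iff]
    by_cases hs : msize α + j + l = N
    · by_cases h0 : msize α + j = 0
      · obtain ⟨h1, rfl⟩ := Nat.add_eq_zero_iff.1 h0
        obtain rfl := hmsize.1 h1
        obtain rfl : l = N := by omega
        have hnil : multiIndexList (0 : Fin n → ℕ) = [] := by
          rw [← List.length_eq_zero_iff, length_multiIndexList, h1]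
        simp [mderiv, hnil, derivAlong, h1, mfact, hpi0 x hx ξ hξ, hppar l le_rfl x hx ξ hξ, hN0,
          sub_mul]
      · have hne : ¬ (α = 0 ∧ j = 0) := fun h => h0 (by rw [hmsize.2 h.1, h.2])
        have hrhs : (if α = 0 then if j = 0 then if l = N then pSym N x ξ else 0 else 0 else 0)
            = 0 := by
          split_ifs with h1 h2
          exacts [absurd ⟨h1, h2⟩ hne, absurd ⟨h1, h2⟩ hne, rfl, rfl]
        rw [hrhs, if_pos hs, if_pos hs, hpi α j hj h0, hp α l hl, smul_comm ((-Complex.I) ^ _),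
          smul_mul_smul_comm, hsign _ _ _ hs]
        simp
    · have hne : ¬ (α = 0 ∧ j = 0 ∧ l = N) := by
        rintro ⟨rfl, rfl, rfl⟩
        exact hs (by simp [msize])
      rw [if_neg hs, if_neg hs, add_zero]
      split_ifs with h1 h2 h3
      exacts [absurd ⟨h1, h2, h3⟩ hne, rfl, rfl, rfl]
  rw [hR]
  simp only [← Finset.sum_add_distrib]
  rw [Finset.sum_congr rfl fun α _ => Finset.sum_congr rfl fun j hj =>
    Finset.sum_congr rfl fun l hl => hterm α j l
      (Finset.mem_range_succ_iff.1 hj) (Finset.mem_range_succ_iff.1 hl)]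
  rw [Finset.sum_eq_single 0, Finset.sum_eq_single 0, Finset.sum_eq_single N]
  all_goals simp +contextual

end
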